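/- Let a = 1/(4√2), b = 1/4 + 1/(4√2), c = 1/4 − 1/(4√2), and let K_1, K_2, K_3, K_4 be the four 16×4 complex matrices given in the paper's Appendix B.4 (e.g., K_1 has rows (0,0,0,b),(0,0,−a,0),(0,−a,0,0),(b,0,0,0),(0,0,−a,0),(0,0,0,c),(−c,0,0,0),(0,a,0,0),(0,−a,0,0),(−c,0,0,0),(0,0,0,c),(0,0,a,0),(b,0,0,0),(0,a,0,0),(0,0,a,0),(0,0,0,b), and similarly for K_2, K_3, K_4). Then (i) Σ_{i=1}^4 K_i† K_i = 1_4, and (ii) for each of the four Bell states Ψ ∈ {(|00⟩+|11⟩)/√2, (|00⟩−|11⟩)/√2, (|01⟩+|10⟩)/√2, (|01⟩−|10⟩)/√2}, writing E(ρ) = Σ_i K_i ρ K_i†, both four-dimensional reduced output states ρ_A = tr_B[E(|Ψ⟩⟨Ψ|)] and ρ_B = tr_A[E(|Ψ⟩⟨Ψ|)] satisfy ⟨Ψ| ρ_A |Ψ⟩ = ⟨Ψ| ρ_B |Ψ⟩ = 1/2 + 1/(2√2). -/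

import Mathlib

open Matrix

noncomputable section

/-- Encode a pair `(a,b) ∈ {0,…,3}²` as the index `4a+b ∈ Fin 16`. -/
def pr16 (a b : Fin 4) : Fin 16 := ⟨4 * a.val + b.val, by omega⟩

/-- The rank-one projector `|φ⟩⟨φ|`. -/
def outer {d : ℕ} (φ : Fin d → ℂ) : Matrix (Fin d) (Fin d) ℂ :=
  Matrix.of fun i j => φ i * star (φ j)

/-- `⟨ψ| M |ψ⟩`. -/
def fid {d : ℕ} (ψ : Fin d → ℂ) (M : Matrix (Fin d) (Fin d) ℂ) : ℂ :=
  ∑ i, ∑ j, star (ψ i) * M i j * ψ j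

/-- Partial trace over the second (B) output pair of qubits. -/
def trB (M : Matrix (Fin 16) (Fin 16) ℂ) : Matrix (Fin 4) (Fin 4) ℂ :=
  Matrix.of fun a a' => ∑ b : Fin 4, M (pr16 a b) (pr16 a' b)

/-- Partial trace over the first (A) output pair of qubits. -/
def trA (M : Matrix (Fin 16) (Fin 16) ℂ) : Matrix (Fin 4) (Fin 4) ℂ :=
  Matrix.of fun b b' => ∑ a : Fin 4, M (pr16 a b) (pr16 a b')

/-- `a = 1/(4√2)`. -/
def aK : ℂ := ((1 / (4 * Real.sqrt 2) : ℝ) : ℂ)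
/-- `b = 1/4 + 1/(4√2)`. -/
def bK : ℂ := ((1 / 4 + 1 / (4 * Real.sqrt 2) : ℝ) : ℂ)
/-- `c = 1/4 − 1/(4√2)`. -/
def cK : ℂ := ((1 / 4 - 1 / (4 * Real.sqrt 2) : ℝ) : ℂ)

/-- First Kraus operator of the entanglement cloner. -/
def K₁ : Matrix (Fin 16) (Fin 4) ℂ :=
  !![0, 0, 0, bK;  0, 0, -aK, 0;  0, -aK, 0, 0;  bK, 0, 0, 0;
     0, 0, -aK, 0;  0, 0, 0, cK;  -cK, 0, 0, 0;  0, aK, 0, 0;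
     0, -aK, 0, 0;  -cK, 0, 0, 0;  0, 0, 0, cK;  0, 0, aK, 0;
     bK, 0, 0, 0;  0, aK, 0, 0;  0, 0, aK, 0;  0, 0, 0, bK]

/-- Second Kraus operator of the entanglement cloner. -/
def K₂ : Matrix (Fin 16) (Fin 4) ℂ :=
  !![0, 0, cK, 0;  0, 0, 0, -aK;  aK, 0, 0, 0;  0, -cK, 0, 0;
     0, 0, 0, -aK;  0, 0, bK, 0;  0, bK, 0, 0;  -aK, 0, 0, 0;
     aK, 0, 0, 0;  0, bK, 0, 0;  0, 0, bK, 0;  0, 0, 0, aK;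
     0, -cK, 0, 0;  -aK, 0, 0, 0;  0, 0, 0, aK;  0, 0, cK, 0]

/-- Third Kraus operator of the entanglement cloner. -/
def K₃ : Matrix (Fin 16) (Fin 4) ℂ :=
  !![0, -cK, 0, 0;  -aK, 0, 0, 0;  0, 0, 0, aK;  0, 0, cK, 0;
     -aK, 0, 0, 0;  0, -bK, 0, 0;  0, 0, -bK, 0;  0, 0, 0, -aK;
     0, 0, 0, aK;  0, 0, -bK, 0;  0, -bK, 0, 0;  aK, 0, 0, 0;
     0, 0, cK, 0;  0, 0, 0, -aK;  aK, 0, 0, 0;  0, -cK, 0, 0]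

/-- Fourth Kraus operator of the entanglement cloner. -/
def K₄ : Matrix (Fin 16) (Fin 4) ℂ :=
  !![bK, 0, 0, 0;  0, aK, 0, 0;  0, 0, aK, 0;  0, 0, 0, bK;
     0, aK, 0, 0;  cK, 0, 0, 0;  0, 0, 0, -cK;  0, 0, -aK, 0;
     0, 0, aK, 0;  0, 0, 0, -cK;  cK, 0, 0, 0;  0, -aK, 0, 0;
     0, 0, 0, bK;  0, 0, -aK, 0;  0, -aK, 0, 0;  bK, 0, 0, 0]

/-- The channel output `E(|Ψ⟩⟨Ψ|) = ∑ᵢ Kᵢ |Ψ⟩⟨Ψ| Kᵢ†`. -/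
def Eout (Ψ : Fin 4 → ℂ) : Matrix (Fin 16) (Fin 16) ℂ :=
  K₁ * outer Ψ * K₁ᴴ + K₂ * outer Ψ * K₂ᴴ + K₃ * outer Ψ * K₃ᴴ + K₄ * outer Ψ * K₄ᴴ

/-- The four Bell states in `ℂ⁴ ≅ ℂ²⊗ℂ²`. -/
def bell : Fin 4 → (Fin 4 → ℂ)
  | 0 => fun i => ((1 / Real.sqrt 2 : ℝ) : ℂ) * ![1, 0, 0, 1] i
  | 1 => fun i => ((1 / Real.sqrt 2 : ℝ) : ℂ) * ![1, 0, 0, -1] i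
  | 2 => fun i => ((1 / Real.sqrt 2 : ℝ) : ℂ) * ![0, 1, 1, 0] i
  | 3 => fun i => ((1 / Real.sqrt 2 : ℝ) : ℂ) * ![0, 1, -1, 0] i

theorem mul_outer_mul_conjTranspose_apply {m d : ℕ} (K : Matrix (Fin m) (Fin d) ℂ)
    (ψ : Fin d → ℂ) (i j : Fin m) :
    (K * outer ψ * Kᴴ) i j = (K *ᵥ ψ) i * star ((K *ᵥ ψ) j) := by
  have h : outer ψ = vecMulVec ψ (star ψ) := rfl
  rw [h, mul_vecMulVec, vecMulVec_mul, vecMulVec_apply, ← star_mulVec, Pi.star_apply]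

theorem fid_add {d : ℕ} (ψ : Fin d → ℂ) (M N : Matrix (Fin d) (Fin d) ℂ) :
    fid ψ (M + N) = fid ψ M + fid ψ N := by
  simp only [fid, Matrix.add_apply, mul_add, add_mul, Finset.sum_add_distrib]

theorem trB_add (M N : Matrix (Fin 16) (Fin 16) ℂ) : trB (M + N) = trB M + trB N := by
  ext i j
  simp only [trB, of_apply, Matrix.add_apply, Finset.sum_add_distrib]

theorem trA_add (M N : Matrix (Fin 16) (Fin 16) ℂ) : trA (M + N) = trA M + trA N := by
  ext i j
  simp only [trA, of_apply, Matrix.add_apply, Finset.sum_add_distrib]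

/-- The fidelity of the A marginal is the squared norm of the vector obtained by contracting the
A index of `K ψ` with `ψ`. -/
theorem fid_trB_mul_outer (K : Matrix (Fin 16) (Fin 4) ℂ) (ψ : Fin 4 → ℂ) :
    fid ψ (trB (K * outer ψ * Kᴴ)) =
      ∑ b, (∑ a, star (ψ a) * (K *ᵥ ψ) (pr16 a b)) *
        star (∑ a, star (ψ a) * (K *ᵥ ψ) (pr16 a b)) := by
  simp only [fid, trB, of_apply, mul_outer_mul_conjTranspose_apply, star_add, star_mul', star_star,
    Fin.sum_univ_four]
  ring

/-- The fidelity of the B marginal is the squared norm of the vector obtained by contracting the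
B index of `K ψ` with `ψ`. -/
theorem fid_trA_mul_outer (K : Matrix (Fin 16) (Fin 4) ℂ) (ψ : Fin 4 → ℂ) :
    fid ψ (trA (K * outer ψ * Kᴴ)) =
      ∑ a, (∑ b, star (ψ b) * (K *ᵥ ψ) (pr16 a b)) *
        star (∑ b, star (ψ b) * (K *ᵥ ψ) (pr16 a b)) := by
  simp only [fid, trA, of_apply, mul_outer_mul_conjTranspose_apply, star_add, star_mul', star_star,
    Fin.sum_univ_four]
  ring

/-- `1/√2` as a complex number. -/
def invSqrtTwo : ℂ := ((1 / Real.sqrt 2 : ℝ) : ℂ)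

theorem invSqrtTwo_sq : invSqrtTwo ^ 2 = 1 / 2 := by
  rw [invSqrtTwo, ← Complex.ofReal_pow, div_pow, Real.sq_sqrt zero_le_two]
  norm_num

theorem conj_invSqrtTwo : starRingEnd ℂ invSqrtTwo = invSqrtTwo := Complex.conj_ofReal _

theorem ofReal_sqrt_two_inv : ((Real.sqrt 2 : ℝ) : ℂ)⁻¹ = invSqrtTwo := by
  simp [invSqrtTwo]

theorem aK_eq : aK = invSqrtTwo / 4 := by
  simp only [aK, invSqrtTwo]; push_cast; ring

theorem bK_eq : bK = (1 + invSqrtTwo) / 4 := by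
  simp only [bK, invSqrtTwo]; push_cast; ring

theorem cK_eq : cK = (1 - invSqrtTwo) / 4 := by
  simp only [cK, invSqrtTwo]; push_cast; ring

theorem conj_aK : starRingEnd ℂ aK = aK := Complex.conj_ofReal _

theorem conj_bK : starRingEnd ℂ bK = bK := Complex.conj_ofReal _

theorem conj_cK : starRingEnd ℂ cK = cK := Complex.conj_ofReal _

theorem kraus_completeness : K₁ᴴ * K₁ + K₂ᴴ * K₂ + K₃ᴴ * K₃ + K₄ᴴ * K₄ = 1 := by
  have hs := invSqrtTwo_sq
  ext i j
  fin_cases i <;> fin_cases j <;>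
    simp [mul_apply, Fin.sum_univ_succ, K₁, K₂, K₃, K₄, conj_aK, conj_bK, conj_cK] <;>
    simp only [aK_eq, bK_eq, cK_eq] <;> linear_combination hs

theorem fid_bell_Eout (k : Fin 4) :
    fid (bell k) (trB (Eout (bell k))) = (1 + invSqrtTwo) / 2 ∧
    fid (bell k) (trA (Eout (bell k))) = (1 + invSqrtTwo) / 2 := by
  have hs := invSqrtTwo_sq
  have h4 : invSqrtTwo ^ 4 = 1 / 4 := by linear_combination (invSqrtTwo ^ 2 + 1 / 2) * hs
  have h5 : invSqrtTwo ^ 5 = invSqrtTwo / 4 := by linear_combination invSqrtTwo * h4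
  have h6 : invSqrtTwo ^ 6 = 1 / 8 := by linear_combination invSqrtTwo ^ 2 * h4 + 1 / 4 * hs
  simp only [Eout, trB_add, trA_add, fid_add, fid_trB_mul_outer, fid_trA_mul_outer]
  fin_cases k <;> constructor <;>
    simp [mulVec, dotProduct, Fin.sum_univ_four, bell, pr16, K₁, K₂, K₃, K₄, ofReal_sqrt_two_inv,
      conj_invSqrtTwo, conj_aK, conj_bK] <;>
    simp only [aK_eq, bK_eq] <;> ring_nf <;> simp only [h4, h5, h6] <;> ring

/-- The entanglement cloner: the four Kraus operators satisfy completeness, and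
for each of the four Bell states both reduced output states have fidelity
`1/2 + 1/(2√2)` with the input. -/
theorem entanglement_cloner :
    K₁ᴴ * K₁ + K₂ᴴ * K₂ + K₃ᴴ * K₃ + K₄ᴴ * K₄ = 1 ∧
    ∀ k : Fin 4,
      fid (bell k) (trB (Eout (bell k))) = ((1 / 2 + 1 / (2 * Real.sqrt 2) : ℝ) : ℂ) ∧
      fid (bell k) (trA (Eout (bell k))) = ((1 / 2 + 1 / (2 * Real.sqrt 2) : ℝ) : ℂ) := by
  refine ⟨kraus_completeness, fun k => ?_⟩
  have h : ((1 / 2 + 1 / (2 * Real.sqrt 2) : ℝ) : ℂ) = (1 + invSqrtTwo) / 2 := by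
    simp only [invSqrtTwo]; push_cast; ring
  rw [h]
  exact fid_bell_Eout k
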